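/- arXiv:2602.00897 — 2 statements merged into one kernel-verified Lean document; each statement's English description precedes it below -/
import Mathlib

section
/- Let N, q ≥ 1, let s_k, …, s_{k+q+1} ∈ ℝ^N and y_0, …, y_{q−1} ∈ ℝ^N, and assume the q×q matrix Y_qᵀ Δ²S_{k,q} is invertible. If γ = (γ_0,…,γ_q) ∈ ℝ^{q+1} satisfies Σ_{j=0}^q γ_j = 1 and Σ_{j=0}^q η_{i,j} γ_j = 0 for all i = 0,…,q−1, then the extrapolated approximation admits the matrix representation Σ_{j=0}^q γ_j s_{k+j} = s_k − ΔS_{k,q} (Y_qᵀ Δ²S_{k,q})^{−1} Y_qᵀ Δs_k. -/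
open Matrix

noncomputable section

/-- First forward difference `Δs_j = s_{j+1} - s_j`. -/
def dls {N : ℕ} (s : ℕ → Fin N → ℝ) (j : ℕ) : Fin N → ℝ := s (j + 1) - s j

/-- Second forward difference `Δ²s_j = Δs_{j+1} - Δs_j`. -/
def d2ls {N : ℕ} (s : ℕ → Fin N → ℝ) (j : ℕ) : Fin N → ℝ := dls s (j + 1) - dls s j

/-- The matrix `Y_q` with columns `y_0, …, y_{q-1}`. -/
def Ymat {N q : ℕ} (y : Fin q → Fin N → ℝ) : Matrix (Fin N) (Fin q) ℝ :=
  Matrix.of fun a i => y i a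

/-- The matrix `ΔS_{k,q}` with columns `Δs_k, …, Δs_{k+q-1}`. -/
def DSmat {N : ℕ} (s : ℕ → Fin N → ℝ) (k q : ℕ) : Matrix (Fin N) (Fin q) ℝ :=
  Matrix.of fun a i => dls s (k + (i : ℕ)) a

/-- The matrix `Δ²S_{k,q}` with columns `Δ²s_k, …, Δ²s_{k+q-1}`. -/
def D2Smat {N : ℕ} (s : ℕ → Fin N → ℝ) (k q : ℕ) : Matrix (Fin N) (Fin q) ℝ :=
  Matrix.of fun a i => d2ls s (k + (i : ℕ)) a

/-- `η_{i,j} = ⟨y_i, Δs_{k+j}⟩` (Euclidean inner product). -/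
def etaCoef {N q : ℕ} (y : Fin q → Fin N → ℝ) (s : ℕ → Fin N → ℝ) (k : ℕ)
    (i : Fin q) (j : Fin (q + 1)) : ℝ :=
  dotProduct (y i) (dls s (k + (j : ℕ)))

/-- Summation by parts, with coefficients that do not depend on the sequence `u`. -/
theorem exists_sum_smul_eq_sum_smul_forward_diff {R M : Type*} [Ring R] [AddCommGroup M]
    [Module R M] (q : ℕ) (γ : Fin (q + 1) → R) :
    ∃ α : Fin q → R, ∀ u : ℕ → M,
      ∑ j, γ j • u (j : ℕ) =
        (∑ j, γ j) • u 0 + ∑ i : Fin q, α i • (u ((i : ℕ) + 1) - u (i : ℕ)) := by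
  induction q with
  | zero => exact ⟨0, fun u => by simp⟩
  | succ q ih =>
    obtain ⟨α, hα⟩ := ih (fun j => γ j.succ)
    refine ⟨Fin.cons (∑ j : Fin (q + 1), γ j.succ) α, fun u => ?_⟩
    rw [Fin.sum_univ_succ, Fin.sum_univ_succ (f := γ),
      Fin.sum_univ_succ (n := q) (f := fun i => (Fin.cons _ α : Fin (q + 1) → R) i • _)]
    simp only [Fin.val_succ, Fin.val_zero, Fin.cons_zero, Fin.cons_succ]
    rw [hα fun n => u (n + 1)]
    simp only [zero_add, add_smul, smul_sub]
    abel

/-- Matrix representation of the extrapolated approximation: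
`Σ γ_j s_{k+j} = s_k − ΔS_{k,q} (Y_qᵀ Δ²S_{k,q})⁻¹ Y_qᵀ Δs_k`. -/
theorem extrap_approx_matrix_form
    (N q k : ℕ) (hN : 1 ≤ N) (hq : 1 ≤ q)
    (s : ℕ → Fin N → ℝ) (y : Fin q → Fin N → ℝ)
    (hdet : ((Ymat y)ᵀ * D2Smat s k q).det ≠ 0)
    (γ : Fin (q + 1) → ℝ)
    (hγ1 : ∑ j, γ j = 1)
    (hγ2 : ∀ i : Fin q, ∑ j, etaCoef y s k i j * γ j = 0) :
    ∑ j, γ j • s (k + (j : ℕ)) =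
      s k - (DSmat s k q).mulVec
        ((((Ymat y)ᵀ * D2Smat s k q)⁻¹).mulVec (((Ymat y)ᵀ).mulVec (dls s k))) := by
  obtain ⟨α, hα⟩ :=
    exists_sum_smul_eq_sum_smul_forward_diff (M := Fin N → ℝ) q γ
  have mulVec_D2Smat : ∑ j, γ j • dls s (k + (j : ℕ)) =
      dls s k + (D2Smat s k q).mulVec α := by
    rw [hα fun n => dls s (k + n), hγ1, one_smul]
    congr 1
    ext a
    simp [mulVec, dotProduct, D2Smat, d2ls, Finset.sum_apply, mul_comm, add_assoc]
  have orthogonal : (Ymat y)ᵀ.mulVec (∑ j, γ j • dls s (k + (j : ℕ))) = 0 := by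
    ext i
    change y i ⬝ᵥ _ = 0
    rw [dotProduct_sum, ← hγ2 i]
    exact Finset.sum_congr rfl fun j _ => by
      rw [dotProduct_smul, smul_eq_mul, mul_comm, etaCoef]
  rw [mulVec_D2Smat, mulVec_add, mulVec_mulVec] at orthogonal
  rw [eq_neg_of_add_eq_zero_left orthogonal, mulVec_neg, mulVec_mulVec,
    nonsing_inv_mul _ (isUnit_iff_ne_zero.mpr hdet), one_mulVec, mulVec_neg, sub_neg_eq_add,
    hα fun n => s (k + n), hγ1, one_smul]
  congr 1
  ext a
  simp [mulVec, dotProduct, DSmat, dls, Finset.sum_apply, mul_comm, add_assoc]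
end
end

section
/- Let N, q ≥ 1, let s_k, …, s_{k+q+1} ∈ ℝ^N and y_0, …, y_{q−1} ∈ ℝ^N, and assume the q×q matrix Y_qᵀ Δ²S_{k,q} is invertible. If γ = (γ_0,…,γ_q) ∈ ℝ^{q+1} satisfies Σ_{j=0}^q γ_j = 1 and Σ_{j=0}^q η_{i,j} γ_j = 0 for all i = 0,…,q−1, then the generalized residual r̃ = Σ_{j=0}^q γ_j s_{k+j+1} − Σ_{j=0}^q γ_j s_{k+j} satisfies r̃ = Δs_k − Δ²S_{k,q} (Y_qᵀ Δ²S_{k,q})^{−1} Y_qᵀ Δs_k. -/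
open Matrix

noncomputable section

/-- Summation by parts: a linear combination of `u 0, …, u q` is the sum of its weights times `u 0`
plus a linear combination of the forward differences of `u`. -/
lemma exists_sum_smul_eq_smul_add_sum_smul_sub {R E : Type*} [Ring R] [AddCommGroup E]
    [Module R E] (q : ℕ) (u : ℕ → E) (γ : Fin (q + 1) → R) :
    ∃ c : Fin q → R, ∑ j, γ j • u j = (∑ j, γ j) • u 0 + ∑ i, c i • (u (i + 1) - u i) := by
  induction q generalizing u with
  | zero => exact ⟨0, by simp⟩
  | succ q ih =>
    obtain ⟨c, hc⟩ := ih (fun n => u (n + 1)) (fun j => γ j.succ)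
    refine ⟨Fin.cons (∑ j : Fin (q + 1), γ j.succ) c, ?_⟩
    rw [Fin.sum_univ_succ (n := q + 1), Fin.sum_univ_succ γ]
    conv_rhs => rw [Fin.sum_univ_succ (n := q) fun i => _ • (_ : E)]
    simp only [Fin.val_succ, Fin.val_zero, Fin.cons_zero, Fin.cons_succ, zero_add] at hc ⊢
    rw [hc, add_smul, smul_sub]
    abel

/-- Matrix representation of the generalized residual:
`r̃ = Δs_k − Δ²S_{k,q} (Y_qᵀ Δ²S_{k,q})⁻¹ Y_qᵀ Δs_k`. -/
theorem generalized_residual_matrix_form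
    (N q k : ℕ) (hN : 1 ≤ N) (hq : 1 ≤ q)
    (s : ℕ → Fin N → ℝ) (y : Fin q → Fin N → ℝ)
    (hdet : ((Ymat y)ᵀ * D2Smat s k q).det ≠ 0)
    (γ : Fin (q + 1) → ℝ)
    (hγ1 : ∑ j, γ j = 1)
    (hγ2 : ∀ i : Fin q, ∑ j, etaCoef y s k i j * γ j = 0) :
    (∑ j, γ j • s (k + (j : ℕ) + 1)) - (∑ j, γ j • s (k + (j : ℕ))) =
      dls s k - (D2Smat s k q).mulVec
        ((((Ymat y)ᵀ * D2Smat s k q)⁻¹).mulVec (((Ymat y)ᵀ).mulVec (dls s k))) := by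
  obtain ⟨c, hc⟩ := exists_sum_smul_eq_smul_add_sum_smul_sub q (fun n => dls s (k + n)) γ
  have hD : ∑ i, c i • (dls s (k + ((i : ℕ) + 1)) - dls s (k + i)) = D2Smat s k q *ᵥ c := by
    ext a
    simp [mulVec, dotProduct, D2Smat, d2ls, mul_comm, add_assoc]
  simp only [hγ1, one_smul, add_zero, hD] at hc
  have hr : (∑ j, γ j • s (k + (j : ℕ) + 1)) - ∑ j, γ j • s (k + (j : ℕ)) =
      ∑ j, γ j • dls s (k + (j : ℕ)) := by
    simp [dls, smul_sub]
  have hY : (Ymat y)ᵀ *ᵥ (∑ j, γ j • dls s (k + (j : ℕ))) = 0 := by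
    ext i
    change y i ⬝ᵥ (∑ j, γ j • dls s (k + (j : ℕ))) = 0
    rw [dotProduct_sum, ← hγ2 i]
    simp [etaCoef, mul_comm]
  rw [hc, mulVec_add, mulVec_mulVec] at hY
  rw [hr, hc, eq_neg_of_add_eq_zero_left hY, mulVec_neg, mulVec_mulVec,
    nonsing_inv_mul _ (isUnit_iff_ne_zero.mpr hdet), one_mulVec, mulVec_neg, sub_neg_eq_add]
end
end
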